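/- Let G be a finite simple graph on vertex set V = {1,…,n} and let d ≥ 2. Suppose there exists an injective realization q : V → ℝ^d such that the framework (G, q) is infinitesimally distance rigid. Then the set of realizations p ∈ (ℝ^d)^V for which p is injective but the framework (G, p) is NOT infinitesimally bearing rigid has Lebesgue measure zero in (ℝ^d)^V. -/

import Mathlib

open scoped RealInnerProductSpace

noncomputable section

/-- `P_{xy} v`: the orthogonal projection matrix `P = I - b bᵀ` (with
`b = (y - x)/‖y - x‖` the bearing from `x` to `y`) applied to the vector `v`. -/
def bproj {d : ℕ} (x y v : EuclideanSpace ℝ (Fin d)) : EuclideanSpace ℝ (Fin d) :=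
  v - ⟪‖y - x‖⁻¹ • (y - x), v⟫ • (‖y - x‖⁻¹ • (y - x))

/-- A framework `(G, p)` is infinitesimally bearing rigid (IBR) if it has at least two
vertices and every infinitesimal motion (`P_ij (u_i − u_j) = 0` on all edges) is an
infinitesimal trivial motion. -/
def IsIBR {d : ℕ} {V : Type*} [Fintype V] (G : SimpleGraph V)
    (p : V → EuclideanSpace ℝ (Fin d)) : Prop :=
  2 ≤ Fintype.card V ∧
    ∀ u : V → EuclideanSpace ℝ (Fin d),
      (∀ i j, G.Adj i j → bproj (p i) (p j) (u i - u j) = 0) →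
      ∃ (α : ℝ) (v : EuclideanSpace ℝ (Fin d)), ∀ i, u i = α • p i + v

/-- A framework `(G, p)` is infinitesimally distance rigid (IDR) if every `u` with
`⟨p_i − p_j, u_i − u_j⟩ = 0` on all edges has the form `u_i = S p_i + v` for a
skew-symmetric matrix `S` and a vector `v`. -/
def IsIDR {d : ℕ} {V : Type*} (G : SimpleGraph V)
    (p : V → EuclideanSpace ℝ (Fin d)) : Prop :=
  ∀ u : V → EuclideanSpace ℝ (Fin d),
    (∀ i j, G.Adj i j → ⟪p i - p j, u i - u j⟫ = 0) →
    ∃ (S : Matrix (Fin d) (Fin d) ℝ) (v : EuclideanSpace ℝ (Fin d)),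
      S.transpose = -S ∧
      ∀ i, u i = (EuclideanSpace.equiv (Fin d) ℝ).symm
          (S.mulVec (EuclideanSpace.equiv (Fin d) ℝ (p i))) + v

open MeasureTheory in
lemma null_of_countable_lines {E : Type*} [NormedAddCommGroup E] [NormedSpace ℝ E]
    [FiniteDimensional ℝ E] [MeasurableSpace E] [BorelSpace E] (μ : Measure E)
    [μ.IsAddHaarMeasure] (Z : Set E) (hZ : IsClosed Z) (q : E)
    (h : ∀ x : E, {t : ℝ | q + t • x ∈ Z}.Countable) : μ Z = 0 := by
  have hm : MeasurableSet {z : E × ℝ | q + z.2 • z.1 ∉ Z} := by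
    have : Continuous fun z : E × ℝ => q + z.2 • z.1 := by fun_prop
    exact (hZ.preimage this).measurableSet.compl
  have h1 : ∀ᵐ x ∂μ, ∀ᵐ t ∂(volume : Measure ℝ), q + t • x ∉ Z := by
    refine Filter.Eventually.of_forall fun x => ?_
    rw [ae_iff]
    simp only [not_not]
    exact (h x).measure_zero _
  have h2 := (Measure.ae_ae_comm (μ := μ) (ν := (volume : Measure ℝ))
    (p := fun x t => q + t • x ∉ Z) hm).1 h1
  have h3 : ∀ᵐ t ∂(volume : Measure ℝ), t ≠ 0 := by
    rw [ae_iff]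
    simp
  obtain ⟨t, ht, ht0⟩ := (h2.and h3).exists
  rw [ae_iff] at ht
  simp only [not_not] at ht
  have e : {x | q + t • x ∈ Z} = (fun x => t • x) ⁻¹' ((fun x => q + x) ⁻¹' Z) := rfl
  rw [e, Measure.addHaar_preimage_smul μ ht0, measure_preimage_add] at ht
  rcases mul_eq_zero.1 ht with h | h
  · exfalso
    rw [ENNReal.ofReal_eq_zero] at h
    have : 0 < |(t ^ Module.finrank ℝ E)⁻¹| := by positivity
    linarith
  · exact h

open MeasureTheory in
lemma null_not_injective {E F H : Type*} [NormedAddCommGroup E] [NormedSpace ℝ E]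
    [FiniteDimensional ℝ E] [MeasurableSpace E] [BorelSpace E] (μ : Measure E)
    [μ.IsAddHaarMeasure] [NormedAddCommGroup F] [NormedSpace ℝ F] [FiniteDimensional ℝ F]
    [NormedAddCommGroup H] [NormedSpace ℝ H]
    (C : F →ₗ[ℝ] H) (T : E →ₗ[ℝ] F →ₗ[ℝ] H) (q : E)
    (hq : Function.Injective (C + T q)) :
    μ {p | ¬ Function.Injective (C + T p)} = 0 := by
  refine null_of_countable_lines μ _ ?_ q ?_
  · have hc : Continuous fun p : E => LinearMap.toContinuousLinearMap (C + T p) := by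
      have : Continuous fun p : E => LinearMap.toContinuousLinearMap (T p) :=
        LinearMap.continuous_of_finiteDimensional
          ((LinearMap.toContinuousLinearMap : (F →ₗ[ℝ] H) ≃ₗ[ℝ] (F →L[ℝ] H)).toLinearMap ∘ₗ T)
      simp only [map_add]
      exact continuous_const.add this
    have ho := (ContinuousLinearMap.isOpen_injective (𝕜 := ℝ) (E := F) (F := H)).preimage hc
    rw [← isOpen_compl_iff]
    convert ho using 1
    ext p
    simp only [Set.mem_compl_iff, Set.mem_ofPred_eq, not_not, Set.mem_preimage]
    rfl
  · intro x
    obtain ⟨L, hL⟩ := LinearMap.exists_leftInverse_of_injective (C + T q)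
      (LinearMap.ker_eq_bot.2 hq)
    have hfin : {s : ℝ | Module.End.HasEigenvalue (L ∘ₗ T x : Module.End ℝ F) s}.Finite :=
      Module.End.finite_hasEigenvalue _
    refine (hfin.image (fun s => - s⁻¹)).countable.mono ?_
    intro t ht
    simp only [Set.mem_ofPred_eq] at ht
    rw [← LinearMap.ker_eq_bot, LinearMap.ker_eq_bot'] at ht
    push Not at ht
    obtain ⟨u, hu, hu0⟩ := ht
    have hLu : L ((C + T q) u) = u := by
      have := LinearMap.congr_fun hL u
      simpa using this
    have h1 : u + t • (L (T x u)) = 0 := by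
      have h2 : L ((C + T (q + t • x)) u) = 0 := by rw [hu, map_zero]
      have h4 : (C + T (q + t • x)) u = (C + T q) u + t • T x u := by
        simp [add_assoc]
      rw [h4, map_add, hLu, map_smul] at h2
      exact h2
    have ht0 : t ≠ 0 := by
      rintro rfl
      simp at h1
      exact hu0 h1
    refine ⟨-t⁻¹, ?_, by simp⟩
    refine Module.End.hasEigenvalue_of_hasEigenvector (x := u) ⟨?_, hu0⟩
    rw [Module.End.mem_eigenspace_iff]
    have h3 : t • (L (T x u)) = -u := by
      rw [eq_neg_iff_add_eq_zero, add_comm]; exact h1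
    show L (T x u) = _
    have : L (T x u) = t⁻¹ • (t • L (T x u)) := by rw [smul_smul, inv_mul_cancel₀ ht0, one_smul]
    rw [this, h3]
    simp

lemma exists_smul_of_cross {d : ℕ} (x w : EuclideanSpace ℝ (Fin d)) (hx : x ≠ 0)
    (h : ∀ a b, x a * w b = x b * w a) : ∃ c : ℝ, w = c • x := by
  have : ∃ a, x a ≠ 0 := by
    by_contra! hc
    exact hx (by ext a; simpa using hc a)
  obtain ⟨a, ha⟩ := this
  refine ⟨w a / x a, ?_⟩
  ext b
  have := h a b
  simp only [PiLp.smul_apply, smul_eq_mul]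
  field_simp
  linarith

lemma IsIDR.coord {d : ℕ} {V : Type*} {G : SimpleGraph V}
    {q : V → EuclideanSpace ℝ (Fin d)} (h : IsIDR G q) (u : V → EuclideanSpace ℝ (Fin d))
    (hu : ∀ i j, G.Adj i j → ∑ a, (q i a - q j a) * (u i a - u j a) = 0) :
    ∃ S : Matrix (Fin d) (Fin d) ℝ, (∀ a b, S a b = - S b a) ∧
      ∀ i j a, u i a - u j a = ∑ b, S a b * (q i b - q j b) := by
  obtain ⟨S, v, hS, hv⟩ := h u (by
    intro i j hij
    rw [← hu i j hij, PiLp.inner_apply]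
    refine Finset.sum_congr rfl fun a _ => ?_
    simp [mul_comm])
  refine ⟨S, fun a b => ?_, fun i j a => ?_⟩
  · have := congrFun (congrFun hS b) a
    simpa using this
  · rw [hv i, hv j]
    simp [Matrix.mulVec, dotProduct, mul_sub, Finset.sum_sub_distrib]

lemma skew_sum {d : ℕ} (S : Matrix (Fin d) (Fin d) ℝ) (hS : ∀ a b, S a b = - S b a)
    (x : Fin d → ℝ) : ∑ a, x a * ∑ b, S a b * x b = 0 := by
  have h : ∑ a, x a * ∑ b, S a b * x b = - ∑ a, x a * ∑ b, S a b * x b := by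
    conv_lhs => simp only [Finset.mul_sum]
    rw [Finset.sum_comm]
    simp only [Finset.mul_sum, ← Finset.sum_neg_distrib]
    refine Finset.sum_congr rfl fun a _ => Finset.sum_congr rfl fun b _ => ?_
    rw [hS b a]; ring
  linarith

lemma IsIDR.cross_all {d : ℕ} {V : Type*} {G : SimpleGraph V}
    {q : V → EuclideanSpace ℝ (Fin d)} (h : IsIDR G q) (u : V → EuclideanSpace ℝ (Fin d))
    (hu : ∀ i j, G.Adj i j → ∀ a b,
      (q i - q j) a * (u i - u j) b = (q i - q j) b * (u i - u j) a) :
    ∀ i j a b, (q i - q j) a * (u i - u j) b = (q i - q j) b * (u i - u j) a := by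
  intro i j a b
  have key : ∀ i j, ∑ c, (q i c - q j c) *
      ((u i b • EuclideanSpace.single a (1 : ℝ) - u i a • EuclideanSpace.single b (1 : ℝ)) c
      - (u j b • EuclideanSpace.single a (1 : ℝ) - u j a • EuclideanSpace.single b (1 : ℝ)) c)
      = (q i - q j) a * (u i - u j) b - (q i - q j) b * (u i - u j) a := by
    intro i j
    simp [Pi.single_apply, mul_sub, Finset.sum_sub_distrib]
    ring
  obtain ⟨S, hS, hw⟩ := h.coord
    (fun i => u i b • EuclideanSpace.single a (1 : ℝ) - u i a • EuclideanSpace.single b (1 : ℝ))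
    (by
      intro i j hij
      rw [key, hu i j hij a b, sub_self])
  have := key i j
  simp only [hw i j] at this
  rw [skew_sum S hS (fun c => q i c - q j c)] at this
  linarith

lemma scale_eq {E : Type*} [AddCommGroup E] [Module ℝ E] (x y : E) (hx : x ≠ 0)
    (hy : ∀ c : ℝ, y ≠ c • x) (l m k : ℝ) (h : m • y - l • x = k • (y - x)) : m = l := by
  have h1 : (m - k) • y = (l - k) • x := by
    have : (m - k) • y - (l - k) • x = (m • y - l • x) - k • (y - x) := by module
    rw [h, sub_self] at this
    exact sub_eq_zero.1 this
  have hmk : m - k = 0 := by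
    by_contra hc
    apply hy ((m - k)⁻¹ * (l - k))
    rw [mul_smul, ← h1, smul_smul, inv_mul_cancel₀ hc, one_smul]
  rw [hmk, zero_smul] at h1
  rcases smul_eq_zero.1 h1.symm with h2 | h2
  · linarith
  · exact absurd h2 hx

lemma IsIDR.core {d : ℕ} {V : Type*} (hd : 2 ≤ d) {G : SimpleGraph V}
    {q : V → EuclideanSpace ℝ (Fin d)} (hq : Function.Injective q)
    (h : IsIDR G q) (v0 v1 : V) (h01 : v0 ≠ v1) (u : V → EuclideanSpace ℝ (Fin d))
    (hu : ∀ i j, G.Adj i j → ∀ a b,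
      (q i - q j) a * (u i - u j) b = (q i - q j) b * (u i - u j) a) :
    ∃ α : ℝ, ∀ i, u i - u v0 = α • (q i - q v0) := by
  classical
  have hpar : ∀ i j, ∃ c : ℝ, u i - u j = c • (q i - q j) := by
    intro i j
    by_cases hij : i = j
    · exact ⟨0, by simp [hij]⟩
    · exact exists_smul_of_cross _ _ (sub_ne_zero.2 (hq.ne hij)) (h.cross_all u hu i j)
  choose c hc using hpar
  have hne : ∀ i j, i ≠ j → q i - q j ≠ 0 := fun i j hij => sub_ne_zero.2 (hq.ne hij)
  have tri : ∀ i j, i ≠ v0 → (∀ s : ℝ, q j - q v0 ≠ s • (q i - q v0)) → c j v0 = c i v0 := by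
    intro i j hi hs
    refine scale_eq _ _ (hne i v0 hi) hs _ _ (c j i) ?_
    rw [← hc, ← hc, sub_sub_sub_cancel_right, sub_sub_sub_cancel_right, hc]
  by_cases hcol : ∀ k, ∃ s : ℝ, q k - q v0 = s • (q v1 - q v0)
  · -- collinear case: only two vertices
    have hx := hne v1 v0 h01.symm
    set x := q v1 - q v0 with hxdef
    have : ∃ a, x a ≠ 0 := by
      by_contra! hc
      exact hx (by ext a; simpa using hc a)
    obtain ⟨a, ha⟩ := this
    have : ∃ b : Fin d, b ≠ a := by
      haveI : Nontrivial (Fin d) := Fin.nontrivial_iff_two_le.2 hd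
      exact exists_ne a
    obtain ⟨b, hb⟩ := this
    have htwo : ∀ k, k ≠ v0 → k = v1 := by
      intro k hk0
      by_contra hk1
      obtain ⟨S, hS, hw⟩ := h.coord
        (fun i => if i = k then
          x b • EuclideanSpace.single a (1 : ℝ) - x a • EuclideanSpace.single b (1 : ℝ) else 0)
        (by
          intro i j _
          have hperp : ∀ i j, ∑ e, (q i e - q j e) *
              (x b • EuclideanSpace.single a (1 : ℝ)
                - x a • EuclideanSpace.single b (1 : ℝ)) e = 0 := by
            intro i j
            obtain ⟨s, hs⟩ := hcol i
            obtain ⟨r, hr⟩ := hcol j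
            have hij : ∀ e, q i e - q j e = (s - r) * x e := by
              intro e
              have h1 := congrArg (fun z : EuclideanSpace ℝ (Fin d) => z e) hs
              have h2 := congrArg (fun z : EuclideanSpace ℝ (Fin d) => z e) hr
              simp only [PiLp.sub_apply, PiLp.smul_apply, smul_eq_mul] at h1 h2
              linarith
            simp only [hij]
            simp [Pi.single_apply, mul_sub, Finset.sum_sub_distrib]
            ring
          have hp := hperp i j
          by_cases hik : i = k <;> by_cases hjk : j = k
          · simp [hik, hjk]
          · simp only [hik, hjk, if_true, if_false, PiLp.zero_apply, sub_zero]
            rw [hik] at hp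
            exact hp
          · simp only [hik, hjk, if_true, if_false, PiLp.zero_apply, zero_sub, mul_neg,
              Finset.sum_neg_distrib]
            rw [hjk] at hp
            rw [hp, neg_zero]
          · simp [hik, hjk])
      have h1 := hw v1 v0 b
      have h2 := hw k v0 b
      obtain ⟨s, hs⟩ := hcol k
      have hks : ∀ e, q k e - q v0 e = s * (q v1 e - q v0 e) := by
        intro e
        have h1 := congrArg (fun z : EuclideanSpace ℝ (Fin d) => z e) hs
        simpa [hxdef] using h1
      have e : ∑ e, S b e * (q k e - q v0 e) = s * ∑ e, S b e * (q v1 e - q v0 e) := by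
        rw [Finset.mul_sum]
        refine Finset.sum_congr rfl fun e _ => ?_
        rw [hks e]; ring
      rw [e, ← h1] at h2
      rw [if_neg (Ne.symm hk1), if_neg (Ne.symm hk0), if_pos rfl] at h2
      simp [hb] at h2
      exact ha h2
    refine ⟨c v1 v0, fun i => ?_⟩
    by_cases hi : i = v0
    · simp [hi]
    · rw [htwo i hi, hc]
  · push Not at hcol
    obtain ⟨k, hk⟩ := hcol
    have hk0 : k ≠ v0 := by
      rintro rfl
      exact hk 0 (by simp)
    have hck := tri v1 k h01.symm hk
    refine ⟨c v1 v0, fun i => ?_⟩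
    by_cases hi : i = v0
    · simp [hi]
    rw [hc]
    congr 1
    by_cases h1 : ∃ s : ℝ, q i - q v0 = s • (q v1 - q v0)
    · obtain ⟨s, hs⟩ := h1
      rw [← hck]
      refine tri k i hk0 fun r hr => ?_
      have hr0 : r ≠ 0 := by
        rintro rfl
        rw [zero_smul] at hr
        exact hne i v0 hi hr
      apply hk (r⁻¹ * s)
      rw [mul_smul, ← hs, hr, smul_smul, inv_mul_cancel₀ hr0, one_smul]
    · push Not at h1
      exact tri v1 i h01.symm h1

lemma cross_of_bproj {d : ℕ} (x y w : EuclideanSpace ℝ (Fin d)) (h : bproj x y w = 0)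
    (a b : Fin d) : (x - y) a * w b = (x - y) b * w a := by
  unfold bproj at h
  rw [sub_eq_zero, smul_smul] at h
  set r := ⟪‖y - x‖⁻¹ • (y - x), w⟫ * ‖y - x‖⁻¹
  rw [h]
  simp only [PiLp.sub_apply, PiLp.smul_apply, smul_eq_mul]
  ring

open Classical in
/-- The part of the (augmented) bearing operator that is linear in the realization `p`. -/
def crossOp {d : ℕ} {V : Type*} [Fintype V] (G : SimpleGraph V) (v0 v1 : V)
    (n : EuclideanSpace ℝ (Fin d)) :
    (V → EuclideanSpace ℝ (Fin d)) →ₗ[ℝ] ((V → EuclideanSpace ℝ (Fin d)) × ℝ) →ₗ[ℝ]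
      ((V → V → Fin d → Fin d → ℝ) × EuclideanSpace ℝ (Fin d) × ℝ × ℝ) :=
  LinearMap.mk₂ ℝ (fun p u =>
    (fun i j a b => if G.Adj i j then
        (p i - p j) a * (u.1 i - u.1 j) b - (p i - p j) b * (u.1 i - u.1 j) a else 0,
      0, 0, ⟪n, p v1 - p v0⟫ * u.2))
    (by
      intro p p' u
      refine Prod.ext ?_ (Prod.ext ?_ (Prod.ext ?_ ?_))
      · funext i j a b
        by_cases h : G.Adj i j <;> simp [h]
        ring
      · simp
      · simp
      · simp [inner_add_right, inner_sub_right]; ring)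
    (by
      intro s p u
      refine Prod.ext ?_ (Prod.ext ?_ (Prod.ext ?_ ?_))
      · funext i j a b
        by_cases h : G.Adj i j <;> simp [h]
        ring
      · simp
      · simp
      · simp [inner_smul_right, inner_sub_right]; ring)
    (by
      intro p u u'
      refine Prod.ext ?_ (Prod.ext ?_ (Prod.ext ?_ ?_))
      · funext i j a b
        by_cases h : G.Adj i j <;> simp [h]
        ring
      · simp
      · simp
      · simp; ring)
    (by
      intro s p u
      refine Prod.ext ?_ (Prod.ext ?_ (Prod.ext ?_ ?_))
      · funext i j a b
        by_cases h : G.Adj i j <;> simp [h]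
        ring
      · simp
      · simp
      · simp; ring)

/-- The normalisation part of the augmented bearing operator. -/
def normOp {d : ℕ} {V : Type*} (v0 v1 : V) (n : EuclideanSpace ℝ (Fin d)) :
    ((V → EuclideanSpace ℝ (Fin d)) × ℝ) →ₗ[ℝ]
      ((V → V → Fin d → Fin d → ℝ) × EuclideanSpace ℝ (Fin d) × ℝ × ℝ) where
  toFun u := (0, u.1 v0, ⟪n, u.1 v1 - u.1 v0⟫, 0)
  map_add' u u' := by
    simp [inner_add_right, inner_sub_right]; ring
  map_smul' s u := by
    simp [inner_smul_right, inner_sub_right]; ring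

lemma op_injective_iff {d : ℕ} {V : Type*} [Fintype V] (G : SimpleGraph V) (v0 v1 : V)
    (n : EuclideanSpace ℝ (Fin d)) (p : V → EuclideanSpace ℝ (Fin d)) :
    Function.Injective (normOp v0 v1 n + crossOp G v0 v1 n p) ↔
      (⟪n, p v1 - p v0⟫ ≠ 0 ∧ ∀ u : V → EuclideanSpace ℝ (Fin d),
        (∀ i j, G.Adj i j → ∀ a b,
          (p i - p j) a * (u i - u j) b = (p i - p j) b * (u i - u j) a) →
        u v0 = 0 → ⟪n, u v1 - u v0⟫ = 0 → u = 0) := by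
  classical
  have key : ∀ u : (V → EuclideanSpace ℝ (Fin d)) × ℝ,
      (normOp v0 v1 n + crossOp G v0 v1 n p) u = 0 ↔
      ((∀ i j, G.Adj i j → ∀ a b,
          (p i - p j) a * (u.1 i - u.1 j) b = (p i - p j) b * (u.1 i - u.1 j) a) ∧
        u.1 v0 = 0 ∧ ⟪n, u.1 v1 - u.1 v0⟫ = 0 ∧ ⟪n, p v1 - p v0⟫ * u.2 = 0) := by
    intro u
    have e : (normOp v0 v1 n + crossOp G v0 v1 n p) u =
      (fun i j a b => if G.Adj i j then
        (p i - p j) a * (u.1 i - u.1 j) b - (p i - p j) b * (u.1 i - u.1 j) a else 0,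
      u.1 v0, ⟪n, u.1 v1 - u.1 v0⟫, ⟪n, p v1 - p v0⟫ * u.2) := by
      simp only [normOp, crossOp, LinearMap.add_apply, LinearMap.mk₂_apply, LinearMap.coe_mk,
        AddHom.coe_mk, Prod.mk_add_mk, zero_add, add_zero]
    rw [e]
    simp only [Prod.mk_eq_zero]
    refine and_congr ?_ Iff.rfl
    constructor
    · intro h i j hij a b
      have := congrFun (congrFun (congrFun (congrFun h i) j) a) b
      rw [if_pos hij] at this
      exact sub_eq_zero.1 this
    · intro h
      funext i j a b
      by_cases hij : G.Adj i j
      · rw [if_pos hij, h i j hij a b, sub_self]; rfl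
      · rw [if_neg hij]; rfl
  rw [← LinearMap.ker_eq_bot, LinearMap.ker_eq_bot']
  constructor
  · intro h
    refine ⟨fun h0 => ?_, fun u h1 h2 h3 => ?_⟩
    · have := h (0, 1) ((key _).2 (by simp [h0]))
      simp at this
    · have := h (u, 0) ((key _).2 ⟨h1, h2, h3, by simp⟩)
      exact congrArg Prod.fst this
  · rintro ⟨h0, h⟩ u hu
    obtain ⟨h1, h2, h3, h4⟩ := (key u).1 hu
    refine Prod.ext (h u.1 h1 h2 h3) ?_
    exact (mul_eq_zero.1 h4).resolve_left h0

/-- Let `G` be a finite simple graph on `n ≥ 2` vertices and `d ≥ 2`.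
If some injective realization `q` makes `(G, q)` infinitesimally distance rigid, then the
set of injective realizations `p` for which `(G, p)` is NOT infinitesimally bearing rigid
has Lebesgue measure zero in `(ℝ^d)^V`. -/
theorem IDR_implies_IBR_almost_surely
    {d : ℕ} {V : Type*} [Fintype V] (hd : 2 ≤ d) (hcard : 2 ≤ Fintype.card V)
    (G : SimpleGraph V)
    (q : V → EuclideanSpace ℝ (Fin d)) (hq : Function.Injective q)
    (hIDR : IsIDR G q) :
    MeasureTheory.volume
      {p : V → EuclideanSpace ℝ (Fin d) | Function.Injective p ∧ ¬ IsIBR G p} = 0 := by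
  obtain ⟨v0, v1, h01⟩ := Fintype.exists_pair_of_one_lt_card (α := V) (by omega)
  have hn : q v1 - q v0 ≠ 0 := sub_ne_zero.2 (hq.ne h01.symm)
  set n := q v1 - q v0 with hndef
  have hnn : ⟪n, n⟫ ≠ 0 := inner_self_ne_zero.2 hn
  have hqi : Function.Injective (normOp v0 v1 n + crossOp G v0 v1 n q) := by
    rw [op_injective_iff]
    refine ⟨hnn, fun u h1 h2 h3 => ?_⟩
    obtain ⟨α, hα⟩ := hIDR.core hd hq v0 v1 h01 u h1
    rw [hα v1, inner_smul_right] at h3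
    have hα0 := (mul_eq_zero.1 h3).resolve_right hnn
    funext i
    have := hα i
    rw [hα0, zero_smul, h2, sub_zero] at this
    exact this
  refine MeasureTheory.measure_mono_null ?_
    (null_not_injective MeasureTheory.volume (normOp v0 v1 n) (crossOp G v0 v1 n) q hqi)
  rintro p ⟨_, hp⟩ hinj
  apply hp
  rw [op_injective_iff] at hinj
  obtain ⟨h0, hinj⟩ := hinj
  refine ⟨hcard, fun u hu => ?_⟩
  set α := ⟪n, u v1 - u v0⟫ / ⟪n, p v1 - p v0⟫ with hα
  have hz := hinj (fun i => u i - u v0 - α • (p i - p v0)) ?_ (by simp) ?_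
  · refine ⟨α, u v0 - α • p v0, fun i => ?_⟩
    have := congrFun hz i
    simp only [Pi.zero_apply] at this
    rw [sub_eq_zero, sub_eq_iff_eq_add] at this
    rw [this]
    module
  · intro i j hij a b
    have := cross_of_bproj _ _ _ (hu i j hij) a b
    simp only [PiLp.sub_apply, PiLp.smul_apply, smul_eq_mul] at this ⊢
    linear_combination this
  · simp only [sub_self, smul_zero, sub_zero]
    rw [inner_sub_right, inner_smul_right, hα, div_mul_cancel₀ _ h0, sub_self]

end
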